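/- On Minkowski ℝ⁴, let R be a smooth (0,4)-tensor field having Riemann symmetries at every point and satisfying the second Bianchi identity ∂_{[ν} R_{αβ]λμ} = 0 everywhere. If the Ricci trace of R satisfies the Einstein-space condition Ric_{μν} = Λ η_{μν} everywhere for a constant Λ ∈ ℝ, where Ric_{μβ} = η^{αλ} R_{αμλβ}, then the matter current J_{λμβ} = ∂_λ Ric_{μβ} − ∂_μ Ric_{λβ} vanishes identically and the Bel tensor of R is divergence-free: ∂_α B^{αβλμ} = 0 everywhere. -/

import Mathlib

noncomputable section

/-- The `ν`-th coordinate vector of ℝ⁴. -/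
def coordV (ν : Fin 4) : Fin 4 → ℝ := Pi.single ν 1

/-- The coordinate partial derivative `∂_ν f` at `p`. -/
def pd (ν : Fin 4) (f : (Fin 4 → ℝ) → ℝ) (p : Fin 4 → ℝ) : ℝ :=
  fderiv ℝ f p (coordV ν)

/-- The Minkowski metric `η = diag(1, −1, −1, −1)` on ℝ⁴ (its own inverse,
so it is also used to raise indices). -/
def mink (μ ν : Fin 4) : ℝ := if μ = ν then (if μ = 0 then 1 else -1) else 0

/-- A (0,4)-tensor (components) has the Riemann symmetries: antisymmetry in the
first pair, antisymmetry in the second pair, symmetry under interchange of the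
two pairs, and the first Bianchi identity `R_{α[βλμ]} = 0` (equivalent, given
the other symmetries, to the cyclic identity). -/
def RiemannSym (R : Fin 4 → Fin 4 → Fin 4 → Fin 4 → ℝ) : Prop :=
  (∀ α β lam μ, R α β lam μ = - R β α lam μ) ∧
  (∀ α β lam μ, R α β lam μ = - R α β μ lam) ∧
  (∀ α β lam μ, R α β lam μ = R lam μ α β) ∧
  (∀ α β lam μ, R α β lam μ + R α lam μ β + R α μ β lam = 0)

/-- The second Bianchi identity `∂_{[ν} R_{αβ]λμ} = 0` (antisymmetrization over
the three indices `ν, α, β`) for a (0,4)-tensor field `R` on Minkowski ℝ⁴. -/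
def SecondBianchi (R : (Fin 4 → ℝ) → Fin 4 → Fin 4 → Fin 4 → Fin 4 → ℝ) : Prop :=
  ∀ p ν α β lam μ,
    (1/6 : ℝ) *
      (pd ν (fun q => R q α β lam μ) p + pd α (fun q => R q β ν lam μ) p
        + pd β (fun q => R q ν α lam μ) p - pd ν (fun q => R q β α lam μ) p
        - pd α (fun q => R q ν β lam μ) p - pd β (fun q => R q α ν lam μ) p) = 0

/-- The (pointwise) Bel tensor of a (0,4)-tensor `R`, built with the Minkowski
metric `η` (which is its own inverse, so indices are raised with `mink`):
`B_{αβλμ} = R_{αρλσ}R_β{}^ρ{}_μ{}^σ + R_{αρμσ}R_β{}^ρ{}_λ{}^σ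
 − (1/2) η_{αβ} R_{ρτλσ}R^{ρτ}{}_μ{}^σ − (1/2) η_{λμ} R_{αρστ}R_β{}^{ρστ}
 + (1/8) η_{αβ} η_{λμ} R_{ρτσν}R^{ρτσν}`. -/
def Bel (R : Fin 4 → Fin 4 → Fin 4 → Fin 4 → ℝ) (α β lam μ : Fin 4) : ℝ :=
    (∑ ρ, ∑ σ, ∑ ρ', ∑ σ', R α ρ lam σ * mink ρ ρ' * mink σ σ' * R β ρ' μ σ')
  + (∑ ρ, ∑ σ, ∑ ρ', ∑ σ', R α ρ μ σ * mink ρ ρ' * mink σ σ' * R β ρ' lam σ')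
  - (1/2) * mink α β * (∑ ρ, ∑ τ, ∑ σ, ∑ ρ', ∑ τ', ∑ σ',
      mink ρ ρ' * mink τ τ' * mink σ σ' * R ρ τ lam σ * R ρ' τ' μ σ')
  - (1/2) * mink lam μ * (∑ ρ, ∑ σ, ∑ τ, ∑ ρ', ∑ σ', ∑ τ',
      mink ρ ρ' * mink σ σ' * mink τ τ' * R α ρ σ τ * R β ρ' σ' τ')
  + (1/8) * mink α β * mink lam μ * (∑ ρ, ∑ τ, ∑ σ, ∑ ν, ∑ ρ', ∑ τ', ∑ σ', ∑ ν',
      mink ρ ρ' * mink τ τ' * mink σ σ' * mink ν ν' * R ρ τ σ ν * R ρ' τ' σ' ν')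

/-- The Bel tensor of `R` with all four indices raised with `η`. -/
def belUp (R : (Fin 4 → ℝ) → Fin 4 → Fin 4 → Fin 4 → Fin 4 → ℝ)
    (q : Fin 4 → ℝ) (α β lam μ : Fin 4) : ℝ :=
  ∑ α', ∑ β', ∑ lam', ∑ μ',
    mink α α' * mink β β' * mink lam lam' * mink μ μ' * Bel (R q) α' β' lam' μ'

/-- The divergence `∂_α B^{αβλμ}` of the Bel tensor of `R`. -/
def divBel (R : (Fin 4 → ℝ) → Fin 4 → Fin 4 → Fin 4 → Fin 4 → ℝ)
    (p : Fin 4 → ℝ) (β lam μ : Fin 4) : ℝ :=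
  ∑ α, pd α (fun q => belUp R q α β lam μ) p

/-- The Ricci trace of `R`: `Ric_{μβ} = η^{αλ} R_{αμλβ}`. -/
def ricci (R : (Fin 4 → ℝ) → Fin 4 → Fin 4 → Fin 4 → Fin 4 → ℝ)
    (q : Fin 4 → ℝ) (μ β : Fin 4) : ℝ :=
  ∑ α, ∑ lam, mink α lam * R q α μ lam β

/-- The matter current `J_{λμβ} = ∂_λ Ric_{μβ} − ∂_μ Ric_{λβ}`. -/
def matJ (R : (Fin 4 → ℝ) → Fin 4 → Fin 4 → Fin 4 → Fin 4 → ℝ)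
    (p : Fin 4 → ℝ) (lam μ β : Fin 4) : ℝ :=
  pd lam (fun q => ricci R q μ β) p - pd μ (fun q => ricci R q lam β) p

/-- The diagonal entries of the Minkowski metric. -/
def minkDiag (μ : Fin 4) : ℝ := if μ = 0 then 1 else -1

theorem mink_eq_ite (μ ν : Fin 4) : mink μ ν = if μ = ν then minkDiag μ else 0 := rfl

theorem minkDiag_mul_self (μ : Fin 4) : minkDiag μ * minkDiag μ = 1 := by
  unfold minkDiag; split_ifs <;> norm_num

theorem sum_mink_mul (μ : Fin 4) (f : Fin 4 → ℝ) :
    ∑ ν, mink μ ν * f ν = minkDiag μ * f μ := by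
  simp [mink_eq_ite]

/-- The Bel tensor with all contractions carried out on the diagonal. -/
theorem Bel_eq_diag (R : Fin 4 → Fin 4 → Fin 4 → Fin 4 → ℝ) (α β lam μ : Fin 4) :
    Bel R α β lam μ =
      (∑ ρ, ∑ σ, minkDiag ρ * minkDiag σ * (R α ρ lam σ * R β ρ μ σ))
      + (∑ ρ, ∑ σ, minkDiag ρ * minkDiag σ * (R α ρ μ σ * R β ρ lam σ))
      - (1/2) * mink α β * (∑ ρ, ∑ τ, ∑ σ,
          minkDiag ρ * minkDiag τ * minkDiag σ * (R ρ τ lam σ * R ρ τ μ σ))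
      - (1/2) * mink lam μ * (∑ ρ, ∑ σ, ∑ τ,
          minkDiag ρ * minkDiag σ * minkDiag τ * (R α ρ σ τ * R β ρ σ τ))
      + (1/8) * mink α β * mink lam μ * (∑ ρ, ∑ τ, ∑ σ, ∑ ν,
          minkDiag ρ * minkDiag τ * minkDiag σ * minkDiag ν * (R ρ τ σ ν * R ρ τ σ ν)) := by
  unfold Bel
  simp only [mul_assoc, mul_left_comm (R _ _ _ _) (mink _ _), ← Finset.mul_sum, sum_mink_mul]

theorem belUp_eq_diag (R : (Fin 4 → ℝ) → Fin 4 → Fin 4 → Fin 4 → Fin 4 → ℝ)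
    (q : Fin 4 → ℝ) (α β lam μ : Fin 4) :
    belUp R q α β lam μ =
      minkDiag α * minkDiag β * minkDiag lam * minkDiag μ * Bel (R q) α β lam μ := by
  unfold belUp
  simp only [mul_assoc, ← Finset.mul_sum, sum_mink_mul]

/-- The derivative of the Bel tensor in a direction in which `R` has derivative `D`. -/
def belDeriv (R D : Fin 4 → Fin 4 → Fin 4 → Fin 4 → ℝ) (α β lam μ : Fin 4) : ℝ :=
  (∑ ρ, ∑ σ, minkDiag ρ * minkDiag σ * (D α ρ lam σ * R β ρ μ σ + R α ρ lam σ * D β ρ μ σ))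
  + (∑ ρ, ∑ σ, minkDiag ρ * minkDiag σ * (D α ρ μ σ * R β ρ lam σ + R α ρ μ σ * D β ρ lam σ))
  - (1/2) * mink α β * (∑ ρ, ∑ τ, ∑ σ, minkDiag ρ * minkDiag τ * minkDiag σ *
      (D ρ τ lam σ * R ρ τ μ σ + R ρ τ lam σ * D ρ τ μ σ))
  - (1/2) * mink lam μ * (∑ ρ, ∑ σ, ∑ τ, minkDiag ρ * minkDiag σ * minkDiag τ *
      (D α ρ σ τ * R β ρ σ τ + R α ρ σ τ * D β ρ σ τ))
  + (1/8) * mink α β * mink lam μ * (∑ ρ, ∑ τ, ∑ σ, ∑ ν,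
      minkDiag ρ * minkDiag τ * minkDiag σ * minkDiag ν *
        (D ρ τ σ ν * R ρ τ σ ν + R ρ τ σ ν * D ρ τ σ ν))

theorem hasDerivAt_pd {f : (Fin 4 → ℝ) → ℝ} {p : Fin 4 → ℝ} (hf : DifferentiableAt ℝ f p)
    (ν : Fin 4) : HasDerivAt (fun t : ℝ => f (p + t • coordV ν)) (pd ν f p) 0 :=
  hf.hasFDerivAt.hasLineDerivAt _

theorem hasDerivAt_bel {r : ℝ → Fin 4 → Fin 4 → Fin 4 → Fin 4 → ℝ}
    {D : Fin 4 → Fin 4 → Fin 4 → Fin 4 → ℝ} {t : ℝ}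
    (h : ∀ α β lam μ, HasDerivAt (fun s => r s α β lam μ) (D α β lam μ) t)
    (α β lam μ : Fin 4) :
    HasDerivAt (fun s => Bel (r s) α β lam μ) (belDeriv (r t) D α β lam μ) t := by
  simp only [Bel_eq_diag]
  unfold belDeriv
  refine ((((HasDerivAt.fun_sum fun ρ _ => HasDerivAt.fun_sum fun σ _ =>
    ((h _ _ _ _).fun_mul (h _ _ _ _)).const_mul _).fun_add
    (HasDerivAt.fun_sum fun ρ _ => HasDerivAt.fun_sum fun σ _ =>
      ((h _ _ _ _).fun_mul (h _ _ _ _)).const_mul _)).fun_sub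
    ((HasDerivAt.fun_sum fun ρ _ => HasDerivAt.fun_sum fun τ _ => HasDerivAt.fun_sum fun σ _ =>
      ((h _ _ _ _).fun_mul (h _ _ _ _)).const_mul _).const_mul _)).fun_sub
    ((HasDerivAt.fun_sum fun ρ _ => HasDerivAt.fun_sum fun τ _ => HasDerivAt.fun_sum fun σ _ =>
      ((h _ _ _ _).fun_mul (h _ _ _ _)).const_mul _).const_mul _)).fun_add
    ((HasDerivAt.fun_sum fun ρ _ => HasDerivAt.fun_sum fun τ _ => HasDerivAt.fun_sum fun σ _ =>
      HasDerivAt.fun_sum fun ν _ =>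
      ((h _ _ _ _).fun_mul (h _ _ _ _)).const_mul _).const_mul _)

theorem differentiable_bel {R : (Fin 4 → ℝ) → Fin 4 → Fin 4 → Fin 4 → Fin 4 → ℝ}
    (hR : ∀ α β lam μ, Differentiable ℝ fun q => R q α β lam μ) (α β lam μ : Fin 4) :
    Differentiable ℝ fun q => Bel (R q) α β lam μ := by
  simp only [Bel_eq_diag]
  fun_prop

theorem pd_bel {R : (Fin 4 → ℝ) → Fin 4 → Fin 4 → Fin 4 → Fin 4 → ℝ} {p : Fin 4 → ℝ}
    (hR : ∀ α β lam μ, Differentiable ℝ fun q => R q α β lam μ) (ν α β lam μ : Fin 4) :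
    pd ν (fun q => Bel (R q) α β lam μ) p =
      belDeriv (R p) (fun a b c d => pd ν (fun q => R q a b c d) p) α β lam μ := by
  refine (hasDerivAt_pd (differentiable_bel hR α β lam μ p) ν).unique ?_
  simpa using hasDerivAt_bel (r := fun t => R (p + t • coordV ν))
    (fun a b c d => hasDerivAt_pd (hR a b c d p) ν) α β lam μ

/-- Contracting an antisymmetric `A` with a `D` satisfying the Bianchi identity moves the
derivative index of `D` to the free slot. -/
theorem sum_antisymm_mul_bianchi {A : Fin 4 → Fin 4 → ℝ} {D : Fin 4 → Fin 4 → Fin 4 → ℝ}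
    (hA : ∀ α ρ, A α ρ = -A ρ α) (hD : ∀ ν α β, D ν α β = -D ν β α)
    (hc : ∀ ν α β, D ν α β + D α β ν + D β ν α = 0) (β : Fin 4) :
    ∑ α, ∑ ρ, minkDiag α * minkDiag ρ * (A α ρ * D α β ρ) =
      (1/2) * ∑ α, ∑ ρ, minkDiag α * minkDiag ρ * (A α ρ * D β α ρ) := by
  have h : ∑ α, ∑ ρ, minkDiag α * minkDiag ρ * (A α ρ * D α β ρ) =
      ∑ α, ∑ ρ, minkDiag α * minkDiag ρ * (A α ρ * D ρ α β) := by
    rw [Finset.sum_comm]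
    refine Finset.sum_congr rfl fun α _ => Finset.sum_congr rfl fun ρ _ => ?_
    rw [hA ρ α, hD ρ β α]; ring
  have h' : ∑ α, ∑ ρ, minkDiag α * minkDiag ρ * (A α ρ * D β α ρ) =
      ∑ α, ∑ ρ, minkDiag α * minkDiag ρ * (A α ρ * D α β ρ) +
      ∑ α, ∑ ρ, minkDiag α * minkDiag ρ * (A α ρ * D ρ α β) := by
    simp only [← Finset.sum_add_distrib]
    refine Finset.sum_congr rfl fun α _ => Finset.sum_congr rfl fun ρ _ => ?_
    have := hc β α ρ
    have := hD α β ρ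
    rw [show D β α ρ = D α β ρ - D ρ β α by linarith, hD ρ β α]; ring
  linarith

/-- The divergence of the product `R_{αρλσ} R_β{}^ρ{}_μ{}^σ`, where `D ν` plays the role of
`∂_ν R`. -/
theorem divergence_contract_two {R : Fin 4 → Fin 4 → Fin 4 → Fin 4 → ℝ}
    {D : Fin 4 → Fin 4 → Fin 4 → Fin 4 → Fin 4 → ℝ}
    (hR : ∀ α β lam μ, R α β lam μ = -R β α lam μ)
    (hD : ∀ ν α β lam μ, D ν α β lam μ = -D ν β α lam μ)
    (hc : ∀ ν α β lam μ, D ν α β lam μ + D α β ν lam μ + D β ν α lam μ = 0)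
    (hdiv : ∀ ρ lam σ, ∑ α, minkDiag α * D α α ρ lam σ = 0) (β lam μ : Fin 4) :
    ∑ α, minkDiag α * ∑ ρ, ∑ σ, minkDiag ρ * minkDiag σ *
        (D α α ρ lam σ * R β ρ μ σ + R α ρ lam σ * D α β ρ μ σ) =
      (1/2) * ∑ ρ, ∑ τ, ∑ σ, minkDiag ρ * minkDiag τ * minkDiag σ *
        (R ρ τ lam σ * D β ρ τ μ σ) := by
  have key (σ : Fin 4) := sum_antisymm_mul_bianchi (A := fun a b => R a b lam σ)
    (D := fun n a b => D n a b μ σ) (fun a b => hR a b lam σ) (fun n a b => hD n a b μ σ)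
    (fun n a b => hc n a b μ σ) β
  calc _ = ∑ ρ, ∑ σ, minkDiag ρ * minkDiag σ * R β ρ μ σ * ∑ α, minkDiag α * D α α ρ lam σ
        + ∑ σ, minkDiag σ * ∑ α, ∑ ρ, minkDiag α * minkDiag ρ *
          (R α ρ lam σ * D α β ρ μ σ) := by
          simp only [Fin.sum_univ_four]; ring
    _ = _ := by
      simp only [hdiv, key]
      simp only [Fin.sum_univ_four]; ring

/-- The divergence of the product `R_{αρστ} R_β{}^{ρστ}`, where `D ν` plays the role of
`∂_ν R`. -/
theorem divergence_contract_three {R : Fin 4 → Fin 4 → Fin 4 → Fin 4 → ℝ}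
    {D : Fin 4 → Fin 4 → Fin 4 → Fin 4 → Fin 4 → ℝ}
    (hR : ∀ α β lam μ, R α β lam μ = -R β α lam μ)
    (hD : ∀ ν α β lam μ, D ν α β lam μ = -D ν β α lam μ)
    (hc : ∀ ν α β lam μ, D ν α β lam μ + D α β ν lam μ + D β ν α lam μ = 0)
    (hdiv : ∀ ρ lam σ, ∑ α, minkDiag α * D α α ρ lam σ = 0) (β : Fin 4) :
    ∑ α, minkDiag α * ∑ ρ, ∑ σ, ∑ τ, minkDiag ρ * minkDiag σ * minkDiag τ *
        (D α α ρ σ τ * R β ρ σ τ + R α ρ σ τ * D α β ρ σ τ) =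
      (1/2) * ∑ ρ, ∑ τ, ∑ σ, ∑ ν, minkDiag ρ * minkDiag τ * minkDiag σ * minkDiag ν *
        (R ρ τ σ ν * D β ρ τ σ ν) := by
  have move (X : Fin 4 → Fin 4 → Fin 4 → Fin 4 → ℝ) :
      ∑ α, ∑ ρ, ∑ σ, ∑ τ, X α ρ σ τ = ∑ σ, ∑ α, ∑ ρ, ∑ τ, X α ρ σ τ := by
    conv_rhs => rw [Finset.sum_comm]
    exact Finset.sum_congr rfl fun α _ => Finset.sum_comm
  calc _ = ∑ σ, minkDiag σ * ∑ α, minkDiag α * ∑ ρ, ∑ τ, minkDiag ρ * minkDiag τ *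
          (D α α ρ σ τ * R β ρ σ τ + R α ρ σ τ * D α β ρ σ τ) := by
        simp only [Finset.mul_sum]
        rw [move]
        refine Finset.sum_congr rfl fun σ _ => Finset.sum_congr rfl fun α _ =>
          Finset.sum_congr rfl fun ρ _ => Finset.sum_congr rfl fun τ _ => ?_
        ring
    _ = _ := by
        simp only [divergence_contract_two hR hD hc hdiv]
        simp only [Finset.mul_sum]
        conv_rhs => rw [move]
        refine Finset.sum_congr rfl fun σ _ => Finset.sum_congr rfl fun α _ =>
          Finset.sum_congr rfl fun ρ _ => Finset.sum_congr rfl fun τ _ => ?_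
        ring

/-- The algebraic identity behind the divergence formula: `D ν` plays the role of `∂_ν R`. -/
theorem sum_belDeriv_eq_zero {R : Fin 4 → Fin 4 → Fin 4 → Fin 4 → ℝ}
    {D : Fin 4 → Fin 4 → Fin 4 → Fin 4 → Fin 4 → ℝ}
    (hR : ∀ α β lam μ, R α β lam μ = -R β α lam μ)
    (hD : ∀ ν α β lam μ, D ν α β lam μ = -D ν β α lam μ)
    (hc : ∀ ν α β lam μ, D ν α β lam μ + D α β ν lam μ + D β ν α lam μ = 0)
    (hdiv : ∀ ρ lam σ, ∑ α, minkDiag α * D α α ρ lam σ = 0) (β lam μ : Fin 4) :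
    ∑ α, minkDiag α * belDeriv R (D α) α β lam μ = 0 := by
  have trace (G : Fin 4 → ℝ) : ∑ α, minkDiag α * (mink α β * G α) = G β := by
    simp [mink_eq_ite, ← mul_assoc, minkDiag_mul_self]
  have split : ∑ α, minkDiag α * belDeriv R (D α) α β lam μ =
      ∑ α, minkDiag α * (∑ ρ, ∑ σ, minkDiag ρ * minkDiag σ *
        (D α α ρ lam σ * R β ρ μ σ + R α ρ lam σ * D α β ρ μ σ))
      + ∑ α, minkDiag α * (∑ ρ, ∑ σ, minkDiag ρ * minkDiag σ *
        (D α α ρ μ σ * R β ρ lam σ + R α ρ μ σ * D α β ρ lam σ))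
      - (1/2) * ∑ α, minkDiag α * (mink α β *
        ∑ ρ, ∑ τ, ∑ σ, minkDiag ρ * minkDiag τ * minkDiag σ *
          (D α ρ τ lam σ * R ρ τ μ σ + R ρ τ lam σ * D α ρ τ μ σ))
      - (1/2) * mink lam μ * ∑ α, minkDiag α * (∑ ρ, ∑ σ, ∑ τ,
        minkDiag ρ * minkDiag σ * minkDiag τ *
          (D α α ρ σ τ * R β ρ σ τ + R α ρ σ τ * D α β ρ σ τ))
      + (1/8) * mink lam μ * ∑ α, minkDiag α * (mink α β * ∑ ρ, ∑ τ, ∑ σ, ∑ ν,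
        minkDiag ρ * minkDiag τ * minkDiag σ * minkDiag ν *
          (D α ρ τ σ ν * R ρ τ σ ν + R ρ τ σ ν * D α ρ τ σ ν)) := by
    rw [Finset.mul_sum, Finset.mul_sum, Finset.mul_sum, ← Finset.sum_add_distrib,
      ← Finset.sum_sub_distrib, ← Finset.sum_sub_distrib, ← Finset.sum_add_distrib]
    refine Finset.sum_congr rfl fun α _ => ?_
    unfold belDeriv
    ring
  rw [split, divergence_contract_two hR hD hc hdiv, divergence_contract_two hR hD hc hdiv,
    divergence_contract_three hR hD hc hdiv, trace, trace]
  simp only [mul_add, Finset.sum_add_distrib, mul_comm (D _ _ _ _ _) (R _ _ _ _)]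
  ring

theorem pd_neg (ν : Fin 4) (f : (Fin 4 → ℝ) → ℝ) (p : Fin 4 → ℝ) :
    pd ν (fun q => -f q) p = -pd ν f p := by
  simp [pd, fderiv_fun_neg]

theorem pd_const (ν : Fin 4) (c : ℝ) (p : Fin 4 → ℝ) : pd ν (fun _ => c) p = 0 := by
  simp [pd]

theorem pd_const_mul {f : (Fin 4 → ℝ) → ℝ} {p : Fin 4 → ℝ} (hf : DifferentiableAt ℝ f p)
    (ν : Fin 4) (c : ℝ) : pd ν (fun q => c * f q) p = c * pd ν f p := by
  simp [pd, fderiv_const_mul hf]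

theorem pd_sum {f : Fin 4 → (Fin 4 → ℝ) → ℝ} {p : Fin 4 → ℝ}
    (hf : ∀ i, DifferentiableAt ℝ (f i) p) (ν : Fin 4) :
    pd ν (fun q => ∑ i, f i q) p = ∑ i, pd ν (f i) p := by
  simp [pd, fderiv_fun_sum fun i _ => hf i]

/-- The second Bianchi identity in cyclic form. -/
theorem SecondBianchi.cyclic {R : (Fin 4 → ℝ) → Fin 4 → Fin 4 → Fin 4 → Fin 4 → ℝ}
    (hB : SecondBianchi R) (hR : ∀ p α β lam μ, R p α β lam μ = -R p β α lam μ)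
    (p : Fin 4 → ℝ) (ν α β lam μ : Fin 4) :
    pd ν (fun q => R q α β lam μ) p + pd α (fun q => R q β ν lam μ) p
      + pd β (fun q => R q ν α lam μ) p = 0 := by
  have swap (ν a b : Fin 4) :
      pd ν (fun q => R q a b lam μ) p = -pd ν (fun q => R q b a lam μ) p := by
    rw [← pd_neg]
    exact congrArg (fun f => pd ν f p) (funext fun q => hR q a b lam μ)
  linarith [hB p ν α β lam μ, swap ν α β, swap α β ν, swap β ν α]

theorem pd_ricci {R : (Fin 4 → ℝ) → Fin 4 → Fin 4 → Fin 4 → Fin 4 → ℝ} {p : Fin 4 → ℝ}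
    (hR : ∀ α β lam μ, Differentiable ℝ fun q => R q α β lam μ) (ν μ β : Fin 4) :
    pd ν (fun q => ricci R q μ β) p = ∑ α, minkDiag α * pd ν (fun q => R q α μ α β) p := by
  simp only [ricci, sum_mink_mul]
  rw [pd_sum fun i => ((hR i μ i β).const_mul _) p]
  exact Finset.sum_congr rfl fun i _ => pd_const_mul (hR i μ i β p) _ _

/-- The contracted Bianchi identity: the divergence of `R` is its matter current. -/
theorem sum_pd_eq_matJ {R : (Fin 4 → ℝ) → Fin 4 → Fin 4 → Fin 4 → Fin 4 → ℝ}
    (hsmooth : ∀ α β lam μ, Differentiable ℝ fun q => R q α β lam μ)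
    (hsym : ∀ p, RiemannSym (R p)) (hB : SecondBianchi R) (p : Fin 4 → ℝ) (ρ lam σ : Fin 4) :
    ∑ α, minkDiag α * pd α (fun q => R q α ρ lam σ) p = matJ R p lam σ ρ := by
  unfold matJ
  rw [pd_ricci hsmooth, pd_ricci hsmooth, ← Finset.sum_sub_distrib]
  refine Finset.sum_congr rfl fun α _ => ?_
  have hc := hB.cyclic (fun p => (hsym p).1) p α lam σ α ρ
  rw [show (fun q => R q α ρ lam σ) = fun q => R q lam σ α ρ from
    funext fun q => (hsym q).2.2.1 _ _ _ _]
  have h : pd lam (fun q => R q σ α α ρ) p = -pd lam (fun q => R q α σ α ρ) p := by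
    rw [← pd_neg]
    exact congrArg (fun f => pd lam f p) (funext fun q => (hsym q).1 _ _ _ _)
  rw [← mul_sub]
  congr 1
  linarith

/-- on Minkowski ℝ⁴, if a smooth (0,4)-tensor field `R` with the
Riemann symmetries satisfies the second Bianchi identity and the Einstein-space
condition `Ric_{μν} = Λ η_{μν}` for a constant `Λ`
(`Ric_{μβ} = η^{αλ} R_{αμλβ}`), then the matter current
`J_{λμβ} = ∂_λ Ric_{μβ} − ∂_μ Ric_{λβ}` vanishes identically and the Bel tensor
of `R` is divergence-free: `∂_α B^{αβλμ} = 0` everywhere. -/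
theorem bel_divergence_free_of_einstein_space
    (R : (Fin 4 → ℝ) → Fin 4 → Fin 4 → Fin 4 → Fin 4 → ℝ)
    (hRsmooth : ∀ α β lam μ, ContDiff ℝ (⊤ : ℕ∞) fun p => R p α β lam μ)
    (hRsym : ∀ p, RiemannSym (R p))
    (hBianchi : SecondBianchi R)
    (Λ : ℝ)
    (hEinstein : ∀ p μ ν, ricci R p μ ν = Λ * mink μ ν) :
    (∀ p lam μ β, matJ R p lam μ β = 0) ∧
      (∀ p β lam μ, divBel R p β lam μ = 0) := by
  have hdiff (α β lam μ : Fin 4) : Differentiable ℝ fun p => R p α β lam μ :=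
    (hRsmooth α β lam μ).differentiable (by simp)
  have hJ (p : Fin 4 → ℝ) (lam μ β : Fin 4) : matJ R p lam μ β = 0 := by
    simp only [matJ, hEinstein, pd_const, sub_self]
  refine ⟨hJ, fun p β lam μ => ?_⟩
  have hpd (α : Fin 4) : pd α (fun q => belUp R q α β lam μ) p =
      (minkDiag β * minkDiag lam * minkDiag μ) * (minkDiag α *
        belDeriv (R p) (fun a b c d => pd α (fun q => R q a b c d) p) α β lam μ) := by
    simp only [belUp_eq_diag]
    rw [pd_const_mul (differentiable_bel hdiff α β lam μ p), pd_bel hdiff]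
    ring
  unfold divBel
  simp only [hpd]
  rw [← Finset.mul_sum, sum_belDeriv_eq_zero
    (D := fun ν a b c d => pd ν (fun q => R q a b c d) p) (hRsym p).1, mul_zero]
  · intro ν a b c d
    rw [← pd_neg]
    exact congrArg (fun f => pd ν f p) (funext fun q => (hRsym q).1 a b c d)
  · exact hBianchi.cyclic (fun q => (hRsym q).1) p
  · exact fun ρ l σ => (sum_pd_eq_matJ hdiff hRsym hBianchi p ρ l σ).trans (hJ p l σ ρ)
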